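/- arXiv:1610.00991 — 2 statements merged into one kernel-verified Lean document; each statement's English description precedes it below -/
import Mathlib

section
/- Let N ≥ 1 and for each s = 1, …, N let K_rr⁽ˢ⁾ be an invertible real symmetric n_r⁽ˢ⁾×n_r⁽ˢ⁾ matrix, K_rc⁽ˢ⁾ a real n_r⁽ˢ⁾×n_c⁽ˢ⁾ matrix, K_cc⁽ˢ⁾ a real symmetric n_c⁽ˢ⁾×n_c⁽ˢ⁾ matrix, and A_c⁽ˢ⁾ a real p×n_c⁽ˢ⁾ matrix. Define the coarse matrix K* = Σ_s A_c⁽ˢ⁾·(K_cc⁽ˢ⁾ − K_rc⁽ˢ⁾ᵀ·(K_rr⁽ˢ⁾)⁻¹·K_rc⁽ˢ⁾)·A_c⁽ˢ⁾ᵀ and assume K* is invertible. Given vectors b⁽ˢ⁾ ∈ ℝ^{n_r⁽ˢ⁾}, define u₁⁽ˢ⁾ = (K_rr⁽ˢ⁾)⁻¹·b⁽ˢ⁾, u_c⁽ˢ⁾ = −A_c⁽ˢ⁾ᵀ·(K*)⁻¹·Σ_j A_c⁽ʲ⁾·K_rc⁽ʲ⁾ᵀ·u₁⁽ʲ⁾,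 u₃⁽ˢ⁾ = −(K_rr⁽ˢ⁾)⁻¹·K_rc⁽ˢ⁾·u_c⁽ˢ⁾, and λ_c⁽ˢ⁾ = K_rc⁽ˢ⁾ᵀ·(u₁⁽ˢ⁾ + u₃⁽ˢ⁾) + K_cc⁽ˢ⁾·u_c⁽ˢ⁾. Then Σ_s A_c⁽ˢ⁾·λ_c⁽ˢ⁾ = 0. -/
open Matrix BigOperators

/-- balance at corner nodes of the reactions produced by the FETI-DP forward
solve: with the coarse matrix `K* = Σ_s A_c⁽ˢ⁾(K_cc⁽ˢ⁾ − K_rc⁽ˢ⁾ᵀK_rr⁽ˢ⁾⁻¹K_rc⁽ˢ⁾)A_c⁽ˢ⁾ᵀ`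
assumed invertible, the corner reactions `λ_c⁽ˢ⁾` satisfy `Σ_s A_c⁽ˢ⁾·λ_c⁽ˢ⁾ = 0`. -/
theorem stmt_11 (Nsd pdim : ℕ) (hN : 1 ≤ Nsd) (nr nc : Fin Nsd → ℕ)
    (Krr : ∀ s : Fin Nsd, Matrix (Fin (nr s)) (Fin (nr s)) ℝ)
    (Krc : ∀ s : Fin Nsd, Matrix (Fin (nr s)) (Fin (nc s)) ℝ)
    (Kcc : ∀ s : Fin Nsd, Matrix (Fin (nc s)) (Fin (nc s)) ℝ)
    (Ac : ∀ s : Fin Nsd, Matrix (Fin pdim) (Fin (nc s)) ℝ)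
    (hKrrUnit : ∀ s, IsUnit (Krr s))
    (hKrrSymm : ∀ s, (Krr s).IsSymm)
    (hKccSymm : ∀ s, (Kcc s).IsSymm)
    (Kstar : Matrix (Fin pdim) (Fin pdim) ℝ)
    (hKstar : Kstar = ∑ s, Ac s * (Kcc s - (Krc s)ᵀ * (Krr s)⁻¹ * Krc s) * (Ac s)ᵀ)
    (hKstarUnit : IsUnit Kstar)
    (b : ∀ s : Fin Nsd, Fin (nr s) → ℝ)
    (u1 : ∀ s : Fin Nsd, Fin (nr s) → ℝ)
    (hu1 : ∀ s, u1 s = ((Krr s)⁻¹).mulVec (b s))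
    (uc : ∀ s : Fin Nsd, Fin (nc s) → ℝ)
    (huc : ∀ s, uc s =
      -(Ac s)ᵀ.mulVec (Kstar⁻¹.mulVec (∑ j, (Ac j).mulVec ((Krc j)ᵀ.mulVec (u1 j)))))
    (u3 : ∀ s : Fin Nsd, Fin (nr s) → ℝ)
    (hu3 : ∀ s, u3 s = -((Krr s)⁻¹).mulVec ((Krc s).mulVec (uc s)))
    (lc : ∀ s : Fin Nsd, Fin (nc s) → ℝ)
    (hlc : ∀ s, lc s = (Krc s)ᵀ.mulVec (u1 s + u3 s) + (Kcc s).mulVec (uc s)) :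
    ∑ s, (Ac s).mulVec (lc s) = 0 := by
  have schur (s : Fin Nsd) : Ac s *ᵥ lc s =
      Ac s *ᵥ ((Krc s)ᵀ *ᵥ u1 s) -
        (Ac s * (Kcc s - (Krc s)ᵀ * (Krr s)⁻¹ * Krc s) * (Ac s)ᵀ) *ᵥ
          (Kstar⁻¹ *ᵥ ∑ j, Ac j *ᵥ ((Krc j)ᵀ *ᵥ u1 j)) := by
    rw [hlc, hu3, huc]
    simp only [← mulVec_mulVec, sub_mulVec, mulVec_add, mulVec_sub, mulVec_neg]
    abel
  simp_rw [schur]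
  rw [Finset.sum_sub_distrib, ← sum_mulVec, ← hKstar, mulVec_mulVec,
    mul_nonsing_inv _ ((isUnit_iff_isUnit_det _).mp hKstarUnit), one_mulVec, sub_self]
end

section
/- Let N ≥ 1 and for each s = 1, …, N let K⁽ˢ⁾ be a real symmetric n⁽ˢ⁾×n⁽ˢ⁾ matrix, and let t_o⁽ˢ⁾ and t_c⁽ˢ⁾ be real matrices with n⁽ˢ⁾ columns (extraction of the non-corner and corner boundary components). Suppose vectors δu⁽ˢ⁾ ∈ ℝ^{n⁽ˢ⁾}, δλ_o⁽ˢ⁾, δλ_c⁽ˢ⁾ satisfy K⁽ˢ⁾·δu⁽ˢ⁾ = t_o⁽ˢ⁾ᵀ·δλ_o⁽ˢ⁾ + t_c⁽ˢ⁾ᵀ·δλ_c⁽ˢ⁾, t_c⁽ˢ⁾·δu⁽ˢ⁾ = 0, and t_o⁽ˢ⁾·δu⁽ˢ⁾ = B̃_o⁽ˢ⁾ᵀ·r for a fixed vector r ∈ ℝᵐ and matrices B̃_o⁽ˢ⁾ with m rows. Define z = Σ_s B̃_o⁽ˢ⁾·δλ_o⁽ˢ⁾. Then Σ_s δu⁽ˢ⁾ᵀ·K⁽ˢ⁾·δu⁽ˢ⁾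 = rᵀ·z. In particular, if each K⁽ˢ⁾ is positive semidefinite then rᵀ·z ≥ 0. -/
open Matrix BigOperators

/-- the FETI-DP energy identity `Σ_s δu⁽ˢ⁾ᵀK⁽ˢ⁾δu⁽ˢ⁾ = rᵀz`, where
`z = Σ_s B̃_o⁽ˢ⁾·δλ_o⁽ˢ⁾`; in particular `rᵀz ≥ 0` when every `K⁽ˢ⁾` is positive
semidefinite. -/
theorem stmt_12 (Nsd m : ℕ) (hN : 1 ≤ Nsd) (ndof ro rc : Fin Nsd → ℕ)
    (K : ∀ s : Fin Nsd, Matrix (Fin (ndof s)) (Fin (ndof s)) ℝ)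
    (hKsymm : ∀ s, (K s).IsSymm)
    (tO : ∀ s : Fin Nsd, Matrix (Fin (ro s)) (Fin (ndof s)) ℝ)
    (tc : ∀ s : Fin Nsd, Matrix (Fin (rc s)) (Fin (ndof s)) ℝ)
    (Bto : ∀ s : Fin Nsd, Matrix (Fin m) (Fin (ro s)) ℝ)
    (du : ∀ s : Fin Nsd, Fin (ndof s) → ℝ)
    (dlo : ∀ s : Fin Nsd, Fin (ro s) → ℝ)
    (dlc : ∀ s : Fin Nsd, Fin (rc s) → ℝ)
    (r : Fin m → ℝ)
    (heq : ∀ s, (K s).mulVec (du s) = (tO s)ᵀ.mulVec (dlo s) + (tc s)ᵀ.mulVec (dlc s))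
    (hcorner : ∀ s, (tc s).mulVec (du s) = 0)
    (hjump : ∀ s, (tO s).mulVec (du s) = (Bto s)ᵀ.mulVec r)
    (z : Fin m → ℝ) (hz : z = ∑ s, (Bto s).mulVec (dlo s)) :
    (∑ s, du s ⬝ᵥ (K s).mulVec (du s)) = r ⬝ᵥ z ∧
    ((∀ s, (K s).PosSemidef) → 0 ≤ r ⬝ᵥ z) := by
  have energy : (∑ s, du s ⬝ᵥ (K s).mulVec (du s)) = r ⬝ᵥ z := by
    rw [hz, dotProduct_sum]
    refine Finset.sum_congr rfl fun s _ => ?_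
    rw [heq, dotProduct_add, dotProduct_mulVec, dotProduct_mulVec, vecMul_transpose,
      vecMul_transpose, hcorner, hjump, zero_dotProduct, add_zero, mulVec_transpose,
      ← dotProduct_mulVec]
  refine ⟨energy, fun hK => energy ▸ Finset.sum_nonneg fun s _ => ?_⟩
  simpa using (hK s).dotProduct_mulVec_nonneg (du s)
end
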